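/- Let T_0 ∈ (0, π) with 2π/T_0 ∉ ℕ, set N := ⌊2π/T_0⌋ and j := ⌊π/T_0⌋, and suppose N is odd and j is even. Define l* := ⌈ T_0 / ((N+1)·T_0 − 2π) ⌉ and q* := ⌈ (π − j·T_0) / ((N+1)·T_0 − 2π) ⌉. Then the set { t > 0 : μ((D(T_0,t))ᶜ) = 0 } is nonempty and: if l* = q* then T_opt(T_0) = 2π·q* + j·T_0, while if l* = q* + 1 then T_opt(T_0) = 2π·q* + j·T_0 + π. -/

import Mathlib

open MeasureTheory Set Real Filter Topology

noncomputable section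

instance : Fact (0 < 2 * Real.pi) := ⟨by positivity⟩

/-- λ_k: 0 for even k, π for odd k. -/
def lam (k : ℕ) : ℝ := if Even k then 0 else Real.pi

/-- Covered set D(T₀, t) ⊆ ℝ/(2πℤ): the union over k of the projections of the
observation intervals (k·T₀, min((k+1)·T₀, t)) translated by −λ_k. -/
def coveredSet (T0 t : ℝ) : Set (AddCircle (2 * Real.pi)) :=
  ⋃ k : ℕ, (fun a : ℝ => ((a - lam k : ℝ) : AddCircle (2 * Real.pi))) ''
    Set.Ioo ((k : ℝ) * T0) (min (((k : ℝ) + 1) * T0) t)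

/-- Optimal control time T_opt(T₀). -/
def Topt (T0 : ℝ) : ℝ :=
  sInf { t : ℝ | 0 < t ∧ volume (coveredSet T0 t)ᶜ = 0 }

theorem cov_of (T0 t y e : ℝ) (j : ℕ) (hT : 0 < T0) (hje : Even j)
    (hpi : Real.pi = ((j : ℝ) + 1) * T0 - e) (h p : ℤ) (hp : Even p)
    (h1 : (p : ℝ) * T0 < y - h * e) (h2 : y - h * e < ((p : ℝ) + 1) * T0)
    (h3 : 0 < y + h * Real.pi) (h4 : y + h * Real.pi < t) :
    (y : AddCircle (2 * Real.pi)) ∈ coveredSet T0 t := by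
  have hk0 : 0 ≤ h * (j + 1) + p := by
    by_contra hneg
    have : h * (j + 1) + p + 1 ≤ 0 := by omega
    have h' : ((h : ℝ) * (j + 1) + p + 1) ≤ 0 := by exact_mod_cast this
    have : y + h * Real.pi < ((h : ℝ) * (j + 1) + p + 1) * T0 := by
      rw [hpi]; linarith
    nlinarith
  obtain ⟨k, hk⟩ := Int.eq_ofNat_of_zero_le hk0
  have hkr : (k : ℝ) = (h : ℝ) * (j + 1) + p := by exact_mod_cast hk.symm
  have hpar : Even k ↔ Even h := by
    have : Even (k : ℤ) ↔ Even h := by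
      rw [← hk]
      have hj' : Even (j : ℤ) := by exact_mod_cast hje
      have hj2 : ¬ Even ((j : ℤ) + 1) := by rw [Int.even_add_one]; simpa using hj'
      rw [Int.even_add, Int.even_mul]
      tauto
    rw [← this]; norm_cast
  refine Set.mem_iUnion.2 ⟨k, y + h * Real.pi, ⟨?_, lt_min ?_ h4⟩, ?_⟩
  · rw [hkr, hpi]; linarith
  · rw [hkr, hpi]; linarith
  · show ((y + h * Real.pi - lam k : ℝ) : AddCircle (2 * Real.pi)) = y
    rw [← sub_eq_zero, ← AddCircle.coe_sub, AddCircle.coe_eq_zero_iff]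
    unfold lam
    by_cases hh : Even h
    · rw [if_pos (hpar.2 hh)]
      obtain ⟨n, rfl⟩ := hh
      exact ⟨n, by simp; ring⟩
    · rw [if_neg (fun hc => hh (hpar.1 hc))]
      obtain ⟨n, rfl⟩ := Int.not_even_iff_odd.1 hh
      exact ⟨n, by simp; ring⟩

theorem of_cov (T0 t y e : ℝ) (j : ℕ) (hT : 0 < T0) (hje : Even j)
    (hpi : Real.pi = ((j : ℝ) + 1) * T0 - e)
    (hy : (y : AddCircle (2 * Real.pi)) ∈ coveredSet T0 t) :
    ∃ h p : ℤ, Even p ∧ (p : ℝ) * T0 < y - h * e ∧ y - h * e < ((p : ℝ) + 1) * T0 ∧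
      0 < y + h * Real.pi ∧ y + h * Real.pi < t := by
  obtain ⟨k, a, ⟨ha1, ha2⟩, ha⟩ := Set.mem_iUnion.1 hy
  have ha3 := lt_of_lt_of_le ha2 (min_le_left _ _)
  have ha4 := lt_of_lt_of_le ha2 (min_le_right _ _)
  have hk0 : 0 ≤ (k : ℝ) * T0 := by positivity
  change ((a - lam k : ℝ) : AddCircle (2 * Real.pi)) = y at ha
  rw [← sub_eq_zero, ← AddCircle.coe_sub, AddCircle.coe_eq_zero_iff] at ha
  obtain ⟨n, hn⟩ := ha
  simp only [zsmul_eq_mul] at hn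
  have key : ∃ h : ℤ, (Even (k : ℤ) ↔ Even h) ∧ a = y + h * Real.pi := by
    unfold lam at hn
    by_cases hk : Even k
    · rw [if_pos hk] at hn
      refine ⟨2 * n, ?_, ?_⟩
      · simp [hk]
      · push_cast; linarith
    · rw [if_neg hk] at hn
      refine ⟨2 * n + 1, ?_, ?_⟩
      · simp [hk]
      · push_cast; linarith
  obtain ⟨h, hpar, rfl⟩ := key
  refine ⟨h, k - h * (j + 1), ?_, ?_, ?_, by linarith, ha4⟩
  · have hj' : Even (j : ℤ) := by exact_mod_cast hje
    rw [Int.even_sub, hpar]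
    have hj2 : ¬ Even ((j : ℤ) + 1) := by rw [Int.even_add_one]; simpa using hj'
    rw [Int.even_mul]
    tauto
  · push_cast; rw [hpi] at ha1; linarith
  · push_cast; rw [hpi] at ha3; linarith

theorem step_down (T0 e z : ℝ) (K : ℕ) (p : ℤ) (he : 0 < e) (heT : e < T0)
    (h1 : (p : ℝ) * T0 ≤ z) (h2 : z - p * T0 < K * e) :
    ∃ i : ℕ, i ≤ K ∧ ((p : ℝ) - 1) * T0 < z - i * e ∧ z - i * e < p * T0 := by
  have hex : ∃ i : ℕ, z - p * T0 < i * e := ⟨K, h2⟩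
  classical
  have hs := Nat.find_spec hex
  refine ⟨Nat.find hex, Nat.find_min' hex h2, ?_, by linarith⟩
  rcases Nat.eq_zero_or_pos (Nat.find hex) with h0 | h0
  · rw [h0] at hs; push_cast at hs; linarith
  · obtain ⟨m, hm⟩ := Nat.exists_eq_succ_of_ne_zero h0.ne'
    have := Nat.find_min hex (m := m) (by omega)
    rw [hm]; push_cast; linarith

theorem cov_start (T0 t y e : ℝ) (j : ℕ) (hT : 0 < T0) (hje : Even j)
    (hpi : Real.pi = ((j : ℝ) + 1) * T0 - e) (he : 0 < e) (heT : e < T0)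
    (a K : ℕ) (hne : ∀ h p : ℤ, y ≠ p * T0 + h * e)
    (h3 : 0 < y + a * Real.pi) (h4 : y + (a + K : ℕ) * Real.pi < t)
    (hK : ∀ p : ℤ, Odd p → (p : ℝ) * T0 < y - a * e → y - a * e < (p + 1) * T0 →
      y - a * e - p * T0 < K * e) :
    (y : AddCircle (2 * Real.pi)) ∈ coveredSet T0 t := by
  set p := ⌊(y - a * e) / T0⌋ with hp
  have f1 : (p : ℝ) * T0 ≤ y - a * e := by
    rw [← le_div_iff₀ hT]; exact Int.floor_le _
  have f2 : y - a * e < (p + 1) * T0 := by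
    rw [← div_lt_iff₀ hT]; exact Int.lt_floor_add_one _
  have f1' : (p : ℝ) * T0 < y - a * e := by
    refine lt_of_le_of_ne f1 fun hc => hne a p ?_
    push_cast; linarith
  have hpp := Real.pi_pos
  rcases Int.even_or_odd p with hev | hod
  · refine cov_of T0 t y e j hT hje hpi a p hev (by push_cast; linarith) (by push_cast; linarith)
      (by push_cast; linarith) ?_
    have : (0 : ℝ) ≤ K * Real.pi := by positivity
    push_cast at h4 ⊢; linarith
  · obtain ⟨i, hiK, g1, g2⟩ := step_down T0 e _ K p he heT f1 (hK p hod f1' f2)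
    have hiK' : (i : ℝ) * Real.pi ≤ K * Real.pi :=
      mul_le_mul_of_nonneg_right (by exact_mod_cast hiK) hpp.le
    have hi0 : (0 : ℝ) ≤ i * Real.pi := by positivity
    refine cov_of T0 t y e j hT hje hpi ((a + i : ℕ) : ℤ) (p - 1) (by
      rw [Int.even_sub_one]; exact Int.not_even_iff_odd.2 hod) ?_ ?_ ?_ ?_
    · push_cast; linarith
    · push_cast; linarith
    · push_cast; linarith
    · push_cast at h4 ⊢; linarith

theorem cov_all (T0 e : ℝ) (j M : ℕ) (hT : 0 < T0) (hje : Even j) (hj2 : 2 ≤ j)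
    (hpi : Real.pi = ((j : ℝ) + 1) * T0 - e) (he : 0 < e) (heT : e < T0)
    (hM : T0 ≤ M * e) (y : ℝ) (hy : y ∈ Set.Ioc (j * T0 - 2 * Real.pi) (j * T0))
    (hne : ∀ h p : ℤ, y ≠ p * T0 + h * e) :
    (y : AddCircle (2 * Real.pi)) ∈ coveredSet T0 (M * Real.pi + j * T0) := by
  have hpp := Real.pi_pos
  have hj2' : (2 : ℝ) ≤ j := by exact_mod_cast hj2
  obtain ⟨y1, y2⟩ := hy
  have y2' : y < j * T0 := lt_of_le_of_ne y2 fun hc => hne 0 j (by push_cast; linarith)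
  have hM2 : 2 ≤ M := by
    by_contra hc
    have : (M : ℝ) ≤ 1 := by exact_mod_cast (by omega : M ≤ 1)
    nlinarith
  have hM2' : (2 : ℝ) ≤ M := by exact_mod_cast hM2
  have hy0 : y ≠ 0 := fun hc => hne 0 0 (by simp [hc])
  have hypi : y ≠ -Real.pi := fun hc => hne 1 (-(j + 1)) (by push_cast; rw [hc, hpi]; ring)
  rcases lt_or_gt_of_ne hy0 with hn | hpos
  · rcases lt_or_gt_of_ne hypi with hn2 | hpos2
    · have hjT : 0 < (j : ℝ) * T0 := by positivity
      refine cov_of T0 _ y e j hT hje hpi 2 (-(j + 2)) (by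
        have hj' : Even (j : ℤ) := by exact_mod_cast hje
        rw [even_neg]; exact hj'.add even_two) ?_ ?_ ?_ ?_
      · push_cast; rw [hpi] at y1; linarith
      · push_cast; rw [hpi] at hn2; linarith
      · push_cast; linarith
      · push_cast; nlinarith
    · rcases lt_or_ge y (-T0 + e) with hs | hs
      · refine cov_start T0 _ y e j hT hje hpi he heT 1 M hne (by push_cast; linarith) ?_ ?_
        · push_cast
          have : y + Real.pi < j * T0 := by rw [hpi]; linarith
          linarith
        · intro p _ g1 g2
          linarith
      · refine cov_start T0 _ y e j hT hje hpi he heT 1 (M - 1) hne (by push_cast; linarith) ?_ ?_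
        · rw [show 1 + (M - 1) = M by omega]; linarith
        · intro p _ g1 g2
          push_cast [Nat.cast_sub (by omega : 1 ≤ M)] at g1 g2 ⊢
          have : (-1 : ℤ) ≤ p := by
            by_contra hc
            have : (p : ℝ) + 1 ≤ -1 := by exact_mod_cast (by omega : p + 1 ≤ -1)
            nlinarith
          have : (-1 : ℝ) ≤ p := by exact_mod_cast this
          nlinarith
  · refine cov_start T0 _ y e j hT hje hpi he heT 0 M hne (by push_cast; linarith) ?_ ?_
    · push_cast; linarith
    · intro p _ g1 g2
      linarith

theorem null_compl (T0 e : ℝ) (j M : ℕ) (hT : 0 < T0) (hje : Even j) (hj2 : 2 ≤ j)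
    (hpi : Real.pi = ((j : ℝ) + 1) * T0 - e) (he : 0 < e) (heT : e < T0)
    (hM : T0 ≤ M * e) :
    volume (coveredSet T0 (M * Real.pi + j * T0))ᶜ = 0 := by
  have hc : (Set.range fun x : ℤ × ℤ =>
      (((x.2 : ℝ) * T0 + x.1 * e : ℝ) : AddCircle (2 * Real.pi))).Countable :=
    Set.countable_range _
  have : NullSingletonClass (volume : Measure (AddCircle (2 * Real.pi))) := by
    constructor
    intro x
    rw [← Metric.closedBall_zero, AddCircle.volume_closedBall]
    simp
  refine measure_mono_null ?_ (hc.measure_zero volume)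
  intro z hz
  by_contra hcon
  obtain ⟨y, hy, rfl⟩ : z ∈ ((↑) : ℝ → AddCircle (2 * Real.pi)) ''
      Set.Ioc (j * T0 - 2 * Real.pi) (j * T0 - 2 * Real.pi + 2 * Real.pi) := by
    rw [AddCircle.coe_image_Ioc_eq]; trivial
  rw [sub_add_cancel] at hy
  exact hz (cov_all T0 e j M hT hje hj2 hpi he heT hM y hy
    fun h p hyp => hcon ⟨(h, p), by rw [hyp]⟩)

theorem lower (T0 e t : ℝ) (j M : ℕ) (hT : 0 < T0) (hje : Even j)
    (hpi : Real.pi = ((j : ℝ) + 1) * T0 - e) (he : 0 < e) (heT : e < T0)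
    (hM : ((M : ℝ) - 1) * e < T0) (ht : t < M * Real.pi + j * T0) :
    volume (coveredSet T0 t)ᶜ ≠ 0 := by
  have hpp := Real.pi_pos
  set d := min (M * Real.pi + j * T0 - t) (T0 - (M - 1) * e) with hd
  have hd0 : 0 < d := lt_min (by linarith) (by linarith)
  have hd1 : d ≤ M * Real.pi + j * T0 - t := min_le_left _ _
  have hd2 : d ≤ T0 - (M - 1) * e := min_le_right _ _
  have hopen : IsOpen (((↑) : ℝ → AddCircle (2 * Real.pi)) '' Set.Ioo (j * T0 - d) (j * T0)) :=
    QuotientAddGroup.isOpenMap_coe _ isOpen_Ioo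
  have hpos := hopen.measure_pos volume ((Set.nonempty_Ioo.2 (by linarith)).image _)
  refine (lt_of_lt_of_le hpos (measure_mono ?_)).ne'
  rintro _ ⟨y, ⟨y1, y2⟩, rfl⟩ hcov
  obtain ⟨h, p, hp, g1, g2, g3, g4⟩ := of_cov T0 t y e j hT hje hpi hcov
  have hh0 : 0 ≤ h := by
    by_contra hc
    have : (h : ℝ) ≤ -1 := by exact_mod_cast (by omega : h ≤ -1)
    have : j * T0 < Real.pi := by rw [hpi]; linarith
    nlinarith
  have hhM : h ≤ M - 1 := by
    by_contra hc
    have : (M : ℝ) ≤ h := by exact_mod_cast (by omega : (M : ℤ) ≤ h)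
    nlinarith
  have hh0' : (0 : ℝ) ≤ h := by exact_mod_cast hh0
  have hhM' : (h : ℝ) ≤ M - 1 := by exact_mod_cast hhM
  have e1 : (h : ℝ) * e ≤ (M - 1) * e := mul_le_mul_of_nonneg_right hhM' he.le
  have e0 : 0 ≤ (h : ℝ) * e := by positivity
  have p1 : (p : ℝ) < j := by
    by_contra hc
    push Not at hc
    nlinarith
  have p2 : (j : ℝ) - 1 < p + 1 := by
    by_contra hc
    push Not at hc
    nlinarith
  have p1' : p < j := by exact_mod_cast p1
  have p2' : (j : ℤ) - 1 < p + 1 := by exact_mod_cast p2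
  have hj' : Even (j : ℤ) := by exact_mod_cast hje
  obtain ⟨a, ha⟩ := hj'
  obtain ⟨b, hb⟩ := hp
  omega

/-- Lemma 1.8 iii): T₀ ∈ (0,π), 2π/T₀ ∉ ℕ, N = ⌊2π/T₀⌋ odd and j = ⌊π/T₀⌋ even. With
l* = ⌈T₀/((N+1)T₀ − 2π)⌉ and q* = ⌈(π − jT₀)/((N+1)T₀ − 2π)⌉, the system is observable
and T_opt = 2πq* + jT₀ if l* = q*, while T_opt = 2πq* + jT₀ + π if l* = q* + 1. -/
theorem stmt_14 (T0 : ℝ) (hT0 : T0 ∈ Set.Ioo 0 Real.pi)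
    (hnotnat : ¬ ∃ m : ℕ, 2 * Real.pi / T0 = (m : ℝ))
    (N j : ℕ) (hN : N = ⌊2 * Real.pi / T0⌋₊) (hj : j = ⌊Real.pi / T0⌋₊)
    (hNo : Odd N) (hje : Even j)
    (lstar qstar : ℕ)
    (hl : lstar = ⌈T0 / (((N : ℝ) + 1) * T0 - 2 * Real.pi)⌉₊)
    (hq : qstar = ⌈(Real.pi - (j : ℝ) * T0) / (((N : ℝ) + 1) * T0 - 2 * Real.pi)⌉₊) :
    { t : ℝ | 0 < t ∧ volume (coveredSet T0 t)ᶜ = 0 }.Nonempty ∧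
      (lstar = qstar → Topt T0 = 2 * Real.pi * (qstar : ℝ) + (j : ℝ) * T0) ∧
      (lstar = qstar + 1 →
        Topt T0 = 2 * Real.pi * (qstar : ℝ) + (j : ℝ) * T0 + Real.pi) := by
  obtain ⟨hT, hTpi⟩ := hT0
  have hpp := Real.pi_pos
  have j1 : (j : ℝ) * T0 ≤ Real.pi := by
    rw [← le_div_iff₀ hT, hj]; exact Nat.floor_le (by positivity)
  have j2 : Real.pi < ((j : ℝ) + 1) * T0 := by
    rw [← div_lt_iff₀ hT, hj]; exact Nat.lt_floor_add_one _
  have n1 : (N : ℝ) * T0 ≤ 2 * Real.pi := by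
    rw [← le_div_iff₀ hT, hN]; exact Nat.floor_le (by positivity)
  have n2 : 2 * Real.pi < ((N : ℝ) + 1) * T0 := by
    rw [← div_lt_iff₀ hT, hN]; exact Nat.lt_floor_add_one _
  have a1 : N < 2 * j + 2 := by
    have : (N : ℝ) < 2 * j + 2 := by
      by_contra hc
      push Not at hc
      nlinarith
    exact_mod_cast this
  have a2 : 2 * j < N + 1 := by
    have : (2 : ℝ) * j < N + 1 := by
      by_contra hc
      push Not at hc
      nlinarith
    exact_mod_cast this
  have hNj : N = 2 * j + 1 := by
    obtain ⟨c, hc⟩ := hNo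
    omega
  have hj2 : 2 ≤ j := by
    have : j ≠ 0 := by
      rintro rfl
      norm_num at j2
      linarith
    obtain ⟨c, hc⟩ := hje
    omega
  have hNr : (N : ℝ) = 2 * j + 1 := by exact_mod_cast hNj
  clear hN hj
  set e : ℝ := (((N : ℝ) + 1) * T0 - 2 * Real.pi) / 2 with hedef
  have hE : ((N : ℝ) + 1) * T0 - 2 * Real.pi = 2 * e := by rw [hedef]; ring
  have hpi : Real.pi = ((j : ℝ) + 1) * T0 - e := by rw [hedef, hNr]; ring
  have he : 0 < e := by linarith
  have heT : e < T0 := by linarith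
  have hnum : Real.pi - j * T0 = T0 - e := by linarith
  rw [hE] at hl hq
  rw [hnum] at hq
  have l1 : T0 ≤ lstar * (2 * e) := by
    rw [← div_le_iff₀ (by positivity), hl]; exact Nat.le_ceil _
  have l2 : ((lstar : ℝ) - 1) * (2 * e) < T0 := by
    rw [← lt_div_iff₀ (by positivity), hl, sub_lt_iff_lt_add]
    exact Nat.ceil_lt_add_one (by positivity)
  have q1 : T0 - e ≤ qstar * (2 * e) := by
    rw [← div_le_iff₀ (by positivity), hq]; exact Nat.le_ceil _
  have q2 : ((qstar : ℝ) - 1) * (2 * e) < T0 - e := by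
    rw [← lt_div_iff₀ (by positivity), hq, sub_lt_iff_lt_add]
    exact Nat.ceil_lt_add_one (div_nonneg (by linarith) (by positivity))
  have c1 : lstar ≤ qstar + 1 := by
    have : (lstar : ℝ) < qstar + 2 := by
      by_contra hc
      push Not at hc
      nlinarith
    have : lstar < qstar + 2 := by exact_mod_cast this
    omega
  have c2 : qstar ≤ lstar := by
    have : (qstar : ℝ) < lstar + 1 := by
      by_contra hc
      push Not at hc
      nlinarith
    have : qstar < lstar + 1 := by exact_mod_cast this
    omega
  have hM1 : T0 ≤ ((lstar + qstar : ℕ) : ℝ) * e := by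
    rcases (by omega : lstar = qstar ∨ lstar = qstar + 1) with h | h <;> subst h <;>
      push_cast at * <;> linarith
  have hM2 : (((lstar + qstar : ℕ) : ℝ) - 1) * e < T0 := by
    rcases (by omega : lstar = qstar ∨ lstar = qstar + 1) with h | h
    · rw [h]; push_cast; linarith
    · have hr : (lstar : ℝ) = qstar + 1 := by exact_mod_cast h
      rw [hr] at l2
      push_cast; rw [hr]; linarith
  have hleast : IsLeast { t : ℝ | 0 < t ∧ volume (coveredSet T0 t)ᶜ = 0 }
      (((lstar + qstar : ℕ) : ℝ) * Real.pi + j * T0) := by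
    constructor
    · refine ⟨?_, null_compl T0 e j _ hT hje hj2 hpi he heT hM1⟩
      have : (0 : ℝ) < j := by exact_mod_cast (by omega : 0 < j)
      positivity
    · rintro t ⟨_, ht⟩
      by_contra hc
      push Not at hc
      exact lower T0 e t j _ hT hje hpi he heT hM2 hc ht
  refine ⟨⟨_, hleast.1⟩, fun h => ?_, fun h => ?_⟩
  · unfold Topt
    rw [hleast.csInf_eq, h]; push_cast; ring
  · unfold Topt
    rw [hleast.csInf_eq, h]; push_cast; ring
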